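/- Let Λ be a dominant weight, W_P the subgroup of W generated by the simple reflections s_γ with ⟨Λ, γ^∨⟩ = 0, and W^P the set of minimal length coset representatives of W/W_P. Let x ∈ W be Λ-minuscule or Λ-cominuscule, S(x) = {α simple root : ⟨x(Λ), α^∨⟩ ≥ 0}, W_x the subgroup of W generated by {s_α : α ∈ S(x)}, and (W_x)^{Q_x} the set of elements w ∈ W_x of minimal length in their coset modulo the stabilizer of x(Λ) in W_x (equivalently, w(β) > 0 for every positive root β of the root subsystem generated by S(x) with ⟨x(Λ), β^∨⟩ = 0). Then for every w ∈ (W_x)^{Q_x}, the product wx lies in W^P. -/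

import Mathlib

namespace KM

/-! ## Jeu de taquin on posets (parametrized by an order relation `r`) -/

namespace JDT

variable {P : Type}

/-- `S` is a lower set (order ideal) for the relation `r`. -/
def IsIdeal (r : P → P → Prop) (S : Set P) : Prop :=
  ∀ ⦃x y : P⦄, r x y → y ∈ S → x ∈ S

/-- `y` covers `x` for the order relation `r`. -/
def Cov (r : P → P → Prop) (x y : P) : Prop :=
  r x y ∧ x ≠ y ∧ ∀ z : P, r x z → r z y → z = x ∨ z = y

/-- A standard tableau for the order relation `r`: a finite set of boxes, labelled
strictly increasingly (w.r.t. `r`) and bijectively by `{1, …, n}`. -/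
structure Tab (r : P → P → Prop) where
  dom : Set P
  finite : dom.Finite
  lab : P → ℕ
  mono : ∀ ⦃x y : P⦄, x ∈ dom → y ∈ dom → r x y → x ≠ y → lab x < lab y
  bij : Set.BijOn lab dom (Set.Icc 1 dom.ncard)

/-- A configuration occurring during a jeu de taquin slide: a set of labelled boxes,
the labelling, and the position of the vacant box. -/
structure Cfg (P : Type) where
  dom : Set P
  lab : P → ℕ
  hole : P

/-- One elementary move inside a jeu de taquin slide: among the labelled boxes covering
the vacant box, the one with the smallest label moves its label into the vacant box,
becoming itself vacant. -/
def InnerStep (r : P → P → Prop) (s t : Cfg P) : Prop :=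
  t.hole ∈ s.dom ∧ Cov r s.hole t.hole ∧
  (∀ z ∈ s.dom, Cov r s.hole z → s.lab t.hole ≤ s.lab z) ∧
  t.dom = insert s.hole (s.dom \ {t.hole}) ∧
  t.lab s.hole = s.lab t.hole ∧ (∀ z : P, z ≠ s.hole → t.lab z = s.lab z)

/-- No labelled box covers the vacant box: the slide stops. -/
def Terminal (r : P → P → Prop) (s : Cfg P) : Prop :=
  ∀ z ∈ s.dom, ¬ Cov r s.hole z

/-- `x` is a valid vacant box to slide into: it lies strictly below some labelled box,
and is maximal among the unlabelled boxes lying strictly below some labelled box. -/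
def IsSlideBox (r : P → P → Prop) (D : Set P) (x : P) : Prop :=
  x ∉ D ∧ (∃ d ∈ D, r x d ∧ x ≠ d) ∧
  ∀ y : P, y ∉ D → (∃ d ∈ D, r y d ∧ y ≠ d) → r x y → x = y

/-- The jeu de taquin slide `j_x` : relation between the labelled configurations
before and after one full slide. -/
def SlideRel (r : P → P → Prop) (A B : Set P × (P → ℕ)) : Prop :=
  ∃ x : P, IsSlideBox r A.1 x ∧
    ∃ e : Cfg P, Relation.ReflTransGen (InnerStep r) ⟨A.1, A.2, x⟩ e ∧
      Terminal r e ∧ B.1 = e.dom ∧ B.2 = e.lab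

/-- `R` is a rectification of `T`: it is obtained from `T` by iterating jeu de taquin
slides, and its shape is an order ideal. -/
def RectifiesTo (r : P → P → Prop) (T R : Tab r) : Prop :=
  Relation.ReflTransGen (SlideRel r) (T.dom, T.lab) (R.dom, R.lab) ∧ IsIdeal r R.dom

/-- The poset has the jeu de taquin property: the rectification of any standard tableau
is independent of all choices made while performing the slides. -/
def HasJdt (r : P → P → Prop) : Prop :=
  ∀ T R R' : Tab r, RectifiesTo r T R → RectifiesTo r T R' → R.dom = R'.dom ∧ R.lab = R'.lab

open scoped Classical in
/-- The jeu de taquin number `t_{λ,μ}^ν`, relative to a choice `U` of a standard tableau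
of each straight shape: the number of standard tableaux of skew shape `ν/λ` whose
rectification is `U μ`; it is `0` if `λ ⊄ ν`. -/
noncomputable def tP (r : P → P → Prop) (U : Set P → Tab r) (lam mu nu : Set P) : ℕ :=
  if lam ⊆ nu then
    Set.ncard {T : Tab r | T.dom = nu \ lam ∧ RectifiesTo r T (U mu)}
  else 0

end JDT

/-! ## Symmetrizable generalized Cartan matrices and their Weyl groups -/

/-- A symmetrizable generalized Cartan matrix `a i j = ⟨α_j, α_i^∨⟩`, together with a
symmetrizer `d` (so that `(α_i, α_j) = d i * a i j` is a symmetric bilinear form with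
`(α_i, α_i) = 2 * d i`). -/
structure SGCM (I : Type) where
  a : I → I → ℤ
  d : I → ℝ
  a_diag : ∀ i, a i i = 2
  a_offdiag : ∀ i j, i ≠ j → a i j ≤ 0
  a_zero_iff : ∀ i j, a i j = 0 → a j i = 0
  d_pos : ∀ i, 0 < d i
  symm : ∀ i j, d i * (a i j : ℝ) = d j * (a j i : ℝ)

variable {I : Type}

/-- The squared length `(α_i, α_i)` of the `i`-th simple root. -/
def SGCM.normSq (G : SGCM I) (i : I) : ℝ := 2 * G.d i

/-- The dual (transposed) generalized Cartan matrix, corresponding to exchanging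
roots and coroots. -/
noncomputable def SGCM.dual (G : SGCM I) : SGCM I where
  a i j := G.a j i
  d i := (G.d i)⁻¹
  a_diag i := G.a_diag i
  a_offdiag i j h := G.a_offdiag j i (Ne.symm h)
  a_zero_iff i j h := G.a_zero_iff j i h
  d_pos i := inv_pos.mpr (G.d_pos i)
  symm i j := by
    have h := G.symm j i
    have hi : G.d i ≠ 0 := ne_of_gt (G.d_pos i)
    have hj : G.d j ≠ 0 := ne_of_gt (G.d_pos j)
    rw [inv_mul_eq_div, inv_mul_eq_div, div_eq_div_iff hi hj]
    linear_combination h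

/-- The simple reflection `s_i` acting on weight coordinates: a weight `λ` is recorded
by its pairings `λ j = ⟨λ, α_j^∨⟩` with the simple coroots, and
`⟨s_i λ, α_j^∨⟩ = ⟨λ, α_j^∨⟩ - ⟨λ, α_i^∨⟩ ⟨α_i, α_j^∨⟩`. -/
def SGCM.srefl (G : SGCM I) (i : I) : Equiv.Perm (I → ℝ) :=
  Function.Involutive.toPerm (fun lam j => lam j - lam i * (G.a j i : ℝ)) (by
    intro lam
    funext j
    have h2 : ((G.a i i : ℤ) : ℝ) = 2 := by rw [G.a_diag i]; norm_num
    dsimp only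
    rw [h2]
    ring)

/-- The product `s_{l 1} ⋯ s_{l n}` of the simple reflections along a word. -/
def SGCM.wordProd (G : SGCM I) (l : List I) : Equiv.Perm (I → ℝ) :=
  (l.map G.srefl).prod

/-- The length of an element of the Weyl group: the minimal length of a word of simple
reflections expressing it. -/
noncomputable def SGCM.length (G : SGCM I) (w : Equiv.Perm (I → ℝ)) : ℕ :=
  sInf {n | ∃ l : List I, l.length = n ∧ G.wordProd l = w}

/-- A word is reduced if no shorter word has the same product. -/
def SGCM.IsReduced (G : SGCM I) (l : List I) : Prop :=
  G.length (G.wordProd l) = l.length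

/-- `w` belongs to the Weyl group (is a product of simple reflections). -/
def SGCM.InW (G : SGCM I) (w : Equiv.Perm (I → ℝ)) : Prop :=
  ∃ l : List I, G.wordProd l = w

/-- The (strong) Bruhat order on the Weyl group, via the subword property. -/
def SGCM.bruhatLE (G : SGCM I) (u w : Equiv.Perm (I → ℝ)) : Prop :=
  ∃ l : List I, G.IsReduced l ∧ G.wordProd l = w ∧
    ∃ l' : List I, l'.Sublist l ∧ G.wordProd l' = u

/-- Peterson's condition: the word `[β_1, …, β_l]` satisfies
`s_{β_k} s_{β_{k+1}} ⋯ s_{β_l} (Λ) = s_{β_{k+1}} ⋯ s_{β_l} (Λ) - β_k`, i.e.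
`⟨s_{β_{k+1}} ⋯ s_{β_l} (Λ), β_k^∨⟩ = 1`, for every `k`. -/
def SGCM.MinusculeWord (G : SGCM I) (Λ : I → ℝ) : List I → Prop
  | [] => True
  | j :: l => G.MinusculeWord Λ l ∧ G.wordProd l Λ j = 1

/-- `w` is `Λ`-minuscule. -/
def SGCM.IsMinuscule (G : SGCM I) (Λ : I → ℝ) (w : Equiv.Perm (I → ℝ)) : Prop :=
  ∃ l : List I, G.IsReduced l ∧ G.wordProd l = w ∧ G.MinusculeWord Λ l

/-- `w` is `Λ`-cominuscule: it is `Λ^∨`-minuscule for the dual root system (where the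
coweight `Λ^∨ = Σ Λ_i ϖ_i^∨` has the same coordinate function as `Λ`). -/
def SGCM.IsCominuscule (G : SGCM I) (Λ : I → ℝ) (w : Equiv.Perm (I → ℝ)) : Prop :=
  ∃ l : List I, G.IsReduced l ∧ G.wordProd l = w ∧ G.dual.MinusculeWord Λ l

/-- `w` is `Λ`-minuscule or `Λ`-cominuscule. -/
def SGCM.IsCoMin (G : SGCM I) (Λ : I → ℝ) (w : Equiv.Perm (I → ℝ)) : Prop :=
  G.IsMinuscule Λ w ∨ G.IsCominuscule Λ w

/-- The simple reflection `s_i` acting on the root lattice `⊕ ℤ α_j` (an element is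
recorded by its coordinates on the simple roots):
`s_i (x) = x - ⟨x, α_i^∨⟩ α_i` with `⟨Σ c_j α_j, α_i^∨⟩ = Σ c_j * a i j`. -/
noncomputable def SGCM.qrefl (G : SGCM I) (i : I) : Equiv.Perm (I →₀ ℤ) :=
  Function.Involutive.toPerm
    (fun x => x - Finsupp.single i (x.sum fun j c => c * G.a i j))
    (by
      intro x
      dsimp only
      have hsub : ∀ y z : I →₀ ℤ,
          ((y - z).sum fun j c => c * G.a i j)
            = (y.sum fun j c => c * G.a i j) - (z.sum fun j c => c * G.a i j) :=
        fun y z => Finsupp.sum_sub_index (fun a b₁ b₂ => by ring)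
      have hsingle : ∀ c : ℤ,
          ((Finsupp.single i c).sum fun j c' => c' * G.a i j) = c * 2 := by
        intro c
        rw [Finsupp.sum_single_index (by ring), G.a_diag i]
      rw [hsub, hsingle]
      have h : (x.sum fun j c => c * G.a i j) - (x.sum fun j c => c * G.a i j) * 2
          = -(x.sum fun j c => c * G.a i j) := by ring
      rw [h, Finsupp.single_neg]
      abel)

/-- The product of the simple reflections along a word, acting on the root lattice. -/
noncomputable def SGCM.qword (G : SGCM I) (l : List I) : Equiv.Perm (I →₀ ℤ) :=
  (l.map G.qrefl).prod

/-! ## Heaps of fully commutative elements -/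

/-- Generating relation for the heap order on the positions of a word: position `p` is
below position `q` when `p` comes later in the word and the corresponding simple
reflections do not commute. -/
def heapBelow (G : SGCM I) (l : List I) (p q : Fin l.length) : Prop :=
  q.1 < p.1 ∧ G.srefl (l.get p) * G.srefl (l.get q) ≠ G.srefl (l.get q) * G.srefl (l.get p)

/-- The heap order on the positions of a word. -/
def heapLE (G : SGCM I) (l : List I) : Fin l.length → Fin l.length → Prop :=
  Relation.ReflTransGen (heapBelow G l)

/-- The subword of `l` consisting of the positions in `S`, in the order of the word. -/
noncomputable def idealWord (l : List I) (S : Set (Fin l.length)) : List I :=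
  ((List.finRange l.length).filter fun p => @decide (p ∈ S) (Classical.propDecidable _)).map
    l.get

open scoped Classical in
/-- The number `m(w)` attached to a `Λ`-(co)minuscule element with reduced word `l`:
the product of `(α, α) / (α_p, α_p)` over all pairs `(p, α)` where `p` is a position of
the word, `α` is a simple root with `⟨Λ, α^∨⟩ > 0` and `(α, α) > (α_p, α_p)`, and `p`
lies above the minimal `α`-coloured element `(α, 1)` of the heap (here `q` runs over the
positions and the first condition states that `q = (α, 1)` for `α` the colour of `q`). -/
noncomputable def mNum (G : SGCM I) (Λ : I → ℝ) (l : List I) : ℝ :=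
  ∏ pq : Fin l.length × Fin l.length,
    if (∀ r, l.get r = l.get pq.2 → heapLE G l pq.2 r) ∧
        0 < Λ (l.get pq.2) ∧
        G.normSq (l.get pq.1) < G.normSq (l.get pq.2) ∧
        heapLE G l pq.2 pq.1
    then G.normSq (l.get pq.2) / G.normSq (l.get pq.1)
    else 1

/-! ## Jeu de taquin numbers for (co)minuscule elements -/

/-- A valid system of choices for computing jeu de taquin numbers of `Λ`-(co)minuscule
elements: `wrd w` is a reduced word for `w`; for `u ≤ w`, `idl w u` is the order ideal
of the heap of `w` corresponding to `u`, and `tab w u` is a standard tableau whose shape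
is that ideal. -/
def ValidChoices (G : SGCM I) (Λ : I → ℝ)
    (wrd : Equiv.Perm (I → ℝ) → List I)
    (idl : (w u : Equiv.Perm (I → ℝ)) → Set (Fin (wrd w).length))
    (tab : (w u : Equiv.Perm (I → ℝ)) → JDT.Tab (heapLE G (wrd w))) : Prop :=
  (∀ w, G.IsCoMin Λ w → G.IsReduced (wrd w) ∧ G.wordProd (wrd w) = w) ∧
  (∀ w u, G.IsCoMin Λ w → G.bruhatLE u w →
      JDT.IsIdeal (heapLE G (wrd w)) (idl w u) ∧
      G.wordProd (idealWord (wrd w) (idl w u)) = u) ∧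
  (∀ w u, G.IsCoMin Λ w → G.bruhatLE u w → (tab w u).dom = idl w u)

open scoped Classical in
/-- The jeu de taquin number `t_{u,v}^w` of three Weyl group elements, computed in the
heap of `w`: the number of standard tableaux of shape `H(w)/λ(u)` rectifying to the
chosen standard tableau of shape `λ(v)`; it is `0` unless `u ≤ w` and `v ≤ w`. -/
noncomputable def tE (G : SGCM I)
    (wrd : Equiv.Perm (I → ℝ) → List I)
    (idl : (w u : Equiv.Perm (I → ℝ)) → Set (Fin (wrd w).length))
    (tab : (w u : Equiv.Perm (I → ℝ)) → JDT.Tab (heapLE G (wrd w)))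
    (u v w : Equiv.Perm (I → ℝ)) : ℕ :=
  if G.bruhatLE u w ∧ G.bruhatLE v w then
    Set.ncard {T : JDT.Tab (heapLE G (wrd w)) |
      T.dom = Set.univ \ idl w u ∧ JDT.RectifiesTo (heapLE G (wrd w)) T (tab w v)}
  else 0

/-- The number `m_{u,v}^w = m(w) / (m(u) · m(v))`. -/
noncomputable def mQuot (G : SGCM I) (Λ : I → ℝ)
    (wrd : Equiv.Perm (I → ℝ) → List I)
    (u v w : Equiv.Perm (I → ℝ)) : ℝ :=
  mNum G Λ (wrd w) / (mNum G Λ (wrd u) * mNum G Λ (wrd v))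

/-- The set `S(x)` of simple roots `α` such that `⟨x(Λ), α^∨⟩ ≥ 0`. -/
def Sx (G : SGCM I) (Λ : I → ℝ) (x : Equiv.Perm (I → ℝ)) : Set I :=
  {α : I | 0 ≤ x Λ α}

/-- The restriction of a symmetrizable GCM to a subset of the index set. -/
def SGCM.restrict (G : SGCM I) (S : Set I) : SGCM ↥S where
  a i j := G.a i.1 j.1
  d i := G.d i.1
  a_diag i := G.a_diag i.1
  a_offdiag i j h := G.a_offdiag i.1 j.1 (fun hv => h (Subtype.ext hv))
  a_zero_iff i j h := G.a_zero_iff i.1 j.1 h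
  d_pos i := G.d_pos i.1
  symm i j := G.symm i.1 j.1

end KM

namespace KM

namespace SGCM

variable {I : Type} (G : SGCM I)

/-! ## Pairing weights with coroot coordinates -/

/-- The pairing of a weight with the element `Σ v_j α_j^∨` of the coroot lattice. -/
noncomputable def pair (lam : I → ℝ) (v : I →₀ ℤ) : ℝ :=
  v.sum fun j c => (c : ℝ) * lam j

lemma pair_zero (lam : I → ℝ) : pair lam 0 = 0 := by
  simp [pair]

lemma pair_add (lam : I → ℝ) (v w : I →₀ ℤ) : pair lam (v + w) = pair lam v + pair lam w :=
  Finsupp.sum_add_index' (by simp) (by intros; push_cast; ring)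

lemma pair_single (lam : I → ℝ) (i : I) (c : ℤ) : pair lam (Finsupp.single i c) = c * lam i := by
  simp [pair]

lemma pair_sub (lam : I → ℝ) (v w : I →₀ ℤ) : pair lam (v - w) = pair lam v - pair lam w := by
  have h := pair_add lam (v - w) w
  rw [sub_add_cancel] at h
  linarith

lemma pair_sub_mul (lam mu : I → ℝ) (c : ℝ) (v : I →₀ ℤ) :
    pair (fun j => lam j - c * mu j) v = pair lam v - c * pair mu v := by
  simp only [pair, Finsupp.sum, Finset.mul_sum, ← Finset.sum_sub_distrib]
  exact Finset.sum_congr rfl fun j _ => by ring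

open Classical in
lemma pair_indicator (j : I) (v : I →₀ ℤ) : pair (Pi.single j 1) v = v j := by
  induction v using Finsupp.induction_linear with
  | zero => simp [pair_zero]
  | add v w hv hw => simp [pair_add, hv, hw]
  | single i c =>
    rw [pair_single]
    by_cases h : i = j
    · subst h; simp
    · simp [h]

lemma eq_of_pair_eq {v w : I →₀ ℤ} (h : ∀ lam, pair lam v = pair lam w) : v = w := by
  classical
  ext j
  have := h (Pi.single j 1)
  rw [pair_indicator, pair_indicator] at this
  exact_mod_cast this

/-- The integer `⟨α_k, Σ v_j α_j^∨⟩`. -/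
noncomputable def rootPair (k : I) (v : I →₀ ℤ) : ℤ := v.sum fun j c => c * G.a j k

lemma cast_rootPair (k : I) (v : I →₀ ℤ) :
    (G.rootPair k v : ℝ) = pair (fun j => (G.a j k : ℝ)) v := by
  simp [rootPair, pair, Finsupp.sum]

lemma rootPair_add (k : I) (v w : I →₀ ℤ) :
    G.rootPair k (v + w) = G.rootPair k v + G.rootPair k w :=
  Finsupp.sum_add_index' (by simp) (by intros; ring)

lemma rootPair_single (k i : I) (c : ℤ) : G.rootPair k (Finsupp.single i c) = c * G.a i k := by
  simp [rootPair]

lemma dual_qrefl_apply (k : I) (v : I →₀ ℤ) :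
    G.dual.qrefl k v = v - Finsupp.single k (G.rootPair k v) := rfl

lemma dual_qrefl_apply_self (k : I) (v : I →₀ ℤ) :
    G.dual.qrefl k v k = v k - G.rootPair k v := by
  simp [dual_qrefl_apply]

lemma dual_qrefl_apply_of_ne {j k : I} (h : j ≠ k) (v : I →₀ ℤ) :
    G.dual.qrefl k v j = v j := by
  simp [dual_qrefl_apply, h.symm]

lemma srefl_apply (k : I) (lam : I → ℝ) :
    G.srefl k lam = fun j => lam j - lam k * (G.a j k : ℝ) := rfl

lemma srefl_mul_self (k : I) : G.srefl k * G.srefl k = 1 :=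
  Equiv.ext (Function.Involutive.toPerm_involutive _)

lemma srefl_inv (k : I) : (G.srefl k)⁻¹ = G.srefl k :=
  inv_eq_of_mul_eq_one_left (G.srefl_mul_self k)

lemma dual_qrefl_dual_qrefl (k : I) (v : I →₀ ℤ) :
    G.dual.qrefl k (G.dual.qrefl k v) = v :=
  Function.Involutive.toPerm_involutive _ v

lemma pair_srefl (k : I) (lam : I → ℝ) (v : I →₀ ℤ) :
    pair (G.srefl k lam) v = pair lam (G.dual.qrefl k v) := by
  rw [srefl_apply, pair_sub_mul, dual_qrefl_apply, pair_sub, pair_single, cast_rootPair]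
  ring

@[simp] lemma wordProd_nil : G.wordProd [] = 1 := rfl

@[simp] lemma wordProd_cons (k : I) (l : List I) :
    G.wordProd (k :: l) = G.srefl k * G.wordProd l := by
  simp [wordProd]

@[simp] lemma wordProd_append (l m : List I) :
    G.wordProd (l ++ m) = G.wordProd l * G.wordProd m := by
  simp [wordProd]

@[simp] lemma qword_nil : G.qword [] = 1 := rfl

@[simp] lemma qword_cons (k : I) (l : List I) :
    G.qword (k :: l) = G.qrefl k * G.qword l := by
  simp [qword]

@[simp] lemma qword_append (l m : List I) :
    G.qword (l ++ m) = G.qword l * G.qword m := by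
  simp [qword]

lemma pair_wordProd (l : List I) (lam : I → ℝ) (v : I →₀ ℤ) :
    pair (G.wordProd l lam) (G.dual.qword l v) = pair lam v := by
  induction l with
  | nil => rfl
  | cons k l ih =>
    rw [wordProd_cons, qword_cons, Equiv.Perm.mul_apply, Equiv.Perm.mul_apply, pair_srefl,
      dual_qrefl_dual_qrefl, ih]

lemma pair_dual_qword (l : List I) (lam : I → ℝ) (v : I →₀ ℤ) :
    pair lam (G.dual.qword l v) = pair ((G.wordProd l)⁻¹ lam) v := by
  have h := G.pair_wordProd l ((G.wordProd l)⁻¹ lam) v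
  rwa [← Equiv.Perm.mul_apply, mul_inv_cancel, Equiv.Perm.one_apply] at h

lemma dual_qword_congr {l m : List I} (h : G.wordProd l = G.wordProd m) (v : I →₀ ℤ) :
    G.dual.qword l v = G.dual.qword m v :=
  eq_of_pair_eq fun lam => by rw [pair_dual_qword, pair_dual_qword, h]

lemma dual_qrefl_add (k : I) (v w : I →₀ ℤ) :
    G.dual.qrefl k (v + w) = G.dual.qrefl k v + G.dual.qrefl k w := by
  simp only [dual_qrefl_apply, rootPair_add, Finsupp.single_add]
  abel

/-- The action of a word on the coroot lattice, as an additive map. -/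
noncomputable def corootHom (l : List I) : (I →₀ ℤ) →+ (I →₀ ℤ) :=
  AddMonoidHom.mk' (G.dual.qword l) (by
    induction l with
    | nil => intros; rfl
    | cons k l ih =>
      intro v w
      simp only [qword_cons, Equiv.Perm.mul_apply, ih, dual_qrefl_add])

lemma corootHom_apply (l : List I) (v : I →₀ ℤ) : G.corootHom l v = G.dual.qword l v := rfl

@[simp] lemma corootHom_nil (v : I →₀ ℤ) : G.corootHom [] v = v := rfl

lemma corootHom_cons (k : I) (l : List I) (v : I →₀ ℤ) :
    G.corootHom (k :: l) v = G.dual.qrefl k (G.corootHom l v) := by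
  simp [corootHom_apply]

lemma corootHom_append (l m : List I) (v : I →₀ ℤ) :
    G.corootHom (l ++ m) v = G.corootHom l (G.corootHom m v) := by
  simp [corootHom_apply]

lemma corootHom_congr {l m : List I} (h : G.wordProd l = G.wordProd m) :
    G.corootHom l = G.corootHom m :=
  AddMonoidHom.ext fun v => G.dual_qword_congr h v

lemma corootHom_apply_of_forall_ne {l : List I} {j : I} (h : ∀ k ∈ l, j ≠ k) (v : I →₀ ℤ) :
    G.corootHom l v j = v j := by
  induction l with
  | nil => rfl
  | cons k l ih =>
    rw [corootHom_cons, dual_qrefl_apply_of_ne _ (h k (by simp)),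
      ih fun m hm => h m (by simp [hm])]

lemma corootHom_nonneg {l : List I} {v : I →₀ ℤ} (hv : 0 ≤ v)
    (h : ∀ k, v k ≠ 0 → 0 ≤ G.corootHom l (Finsupp.single k 1)) : 0 ≤ G.corootHom l v := by
  rw [← Finsupp.sum_single v, Finsupp.sum, map_sum]
  refine Finset.sum_nonneg fun k hk => ?_
  have : Finsupp.single k (v k) = v k • Finsupp.single k (1 : ℤ) := by simp
  rw [this, map_zsmul]
  exact smul_nonneg (hv k) (h k (Finsupp.mem_support_iff.mp hk))

/-! ## The invariant form and reflections -/

/-- The weight identified with `Σ v_j α_j^∨` through the invariant form. -/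
noncomputable def nu (v : I →₀ ℤ) (j : I) : ℝ :=
  pair (fun k => (G.a j k : ℝ) / G.d k) v

lemma rootPair_eq (k : I) (v : I →₀ ℤ) : (G.rootPair k v : ℝ) = G.d k * G.nu v k := by
  rw [cast_rootPair, nu, pair, pair, Finsupp.sum, Finsupp.sum, Finset.mul_sum]
  refine Finset.sum_congr rfl fun j _ => ?_
  have := (G.d_pos j).ne'
  have hs := G.symm k j
  field_simp
  linear_combination (-(v j : ℝ)) * hs

lemma nu_single (i : I) (c : ℤ) (j : I) :
    G.nu (Finsupp.single i c) j = c * (G.a j i / G.d i) := pair_single _ _ _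

lemma nu_dual_qrefl (k : I) (v : I →₀ ℤ) :
    G.nu (G.dual.qrefl k v) = G.srefl k (G.nu v) := by
  funext j
  rw [srefl_apply, dual_qrefl_apply, nu, pair_sub, pair_single, rootPair_eq]
  have := (G.d_pos k).ne'
  simp only [nu]
  field_simp

lemma nu_corootHom (l : List I) (v : I →₀ ℤ) :
    G.nu (G.corootHom l v) = G.wordProd l (G.nu v) := by
  induction l with
  | nil => rfl
  | cons k l ih => rw [corootHom_cons, nu_dual_qrefl, ih, wordProd_cons, Equiv.Perm.mul_apply]

lemma pair_nu_single (i : I) (c : ℤ) :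
    pair (G.nu (Finsupp.single i c)) (Finsupp.single i c) = 2 * c ^ 2 / G.d i := by
  rw [pair_single, nu_single, G.a_diag]
  push_cast
  ring

lemma pair_nu_corootHom (l : List I) (i : I) :
    pair (G.nu (G.corootHom l (Finsupp.single i 1))) (G.corootHom l (Finsupp.single i 1))
      = 2 / G.d i := by
  rw [nu_corootHom, corootHom_apply, pair_wordProd, pair_nu_single]
  simp

lemma corootHom_single_ne_zero (l : List I) (i : I) :
    G.corootHom l (Finsupp.single i 1) ≠ 0 := by
  intro h
  have h2 := G.pair_nu_corootHom l i
  rw [h, pair_zero] at h2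
  have := G.d_pos i
  have : 0 < 2 / G.d i := by positivity
  linarith

lemma wordProd_sub_mul (l : List I) (lam mu : I → ℝ) (c : ℝ) :
    G.wordProd l (fun j => lam j - c * mu j)
      = fun j => G.wordProd l lam j - c * G.wordProd l mu j := by
  induction l with
  | nil => rfl
  | cons k l ih =>
    funext j
    simp only [wordProd_cons, Equiv.Perm.mul_apply, ih, srefl_apply]
    ring

/-- If a Weyl group element maps a simple coroot to a multiple of another one, it
conjugates the corresponding simple reflections. -/
lemma wordProd_mul_srefl {l : List I} {i k : I} {c : ℤ}
    (h : G.corootHom l (Finsupp.single i 1) = Finsupp.single k c) :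
    G.wordProd l * G.srefl i = G.srefl k * G.wordProd l := by
  have hi := (G.d_pos i).ne'
  have hk := (G.d_pos k).ne'
  have hq := G.pair_nu_corootHom l i
  have hnu := G.nu_corootHom l (Finsupp.single i 1)
  rw [h] at hq hnu
  rw [pair_nu_single] at hq
  have hc : (c : ℝ) ^ 2 * G.d i = G.d k := by
    field_simp at hq
    linarith
  ext lam j
  have hp := G.pair_wordProd l lam (Finsupp.single i 1)
  rw [← corootHom_apply, h, pair_single, pair_single] at hp
  have hs : G.srefl i lam = fun j => lam j - (lam i * G.d i) * G.nu (Finsupp.single i 1) j := by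
    funext j
    rw [srefl_apply, nu_single]
    field_simp
    push_cast
    ring
  rw [Equiv.Perm.mul_apply, Equiv.Perm.mul_apply, hs, wordProd_sub_mul, ← hnu, srefl_apply]
  simp only [nu_single]
  push_cast at hp
  rw [one_mul] at hp
  rw [← hp]
  field_simp
  linear_combination (-(G.wordProd l lam k) * (G.a j k : ℝ)) * hc

lemma wordProd_append_mul_srefl {l m : List I} {i k : I} {c : ℤ}
    (h : G.corootHom m (Finsupp.single i 1) = Finsupp.single k c) :
    G.wordProd (l ++ k :: m) * G.srefl i = G.wordProd (l ++ m) := by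
  rw [wordProd_append, wordProd_cons, mul_assoc, mul_assoc, G.wordProd_mul_srefl h,
    ← mul_assoc (G.srefl k), srefl_mul_self, one_mul, wordProd_append]

lemma wordProd_mul_reverse (l : List I) : G.wordProd l * G.wordProd l.reverse = 1 := by
  induction l with
  | nil => rfl
  | cons k l ih =>
    rw [List.reverse_cons, wordProd_append, wordProd_cons, wordProd_cons, wordProd_nil, mul_one,
      mul_assoc, ← mul_assoc (G.wordProd l), ih, one_mul, srefl_mul_self]

lemma corootHom_singleton_self (i : I) :
    G.corootHom [i] (Finsupp.single i 1) = -Finsupp.single i 1 := by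
  rw [corootHom_cons, corootHom_nil, dual_qrefl_apply, rootPair_single, G.a_diag,
    ← Finsupp.single_sub, ← Finsupp.single_neg]
  norm_num

/-! ## Length -/

lemma length_wordProd_le (l : List I) : G.length (G.wordProd l) ≤ l.length :=
  Nat.sInf_le ⟨l, rfl, rfl⟩

lemma exists_reduced (l : List I) :
    ∃ m : List I, G.wordProd m = G.wordProd l ∧ m.length = G.length (G.wordProd l) := by
  obtain ⟨m, h1, h2⟩ := Nat.sInf_mem
    (⟨l.length, l, rfl, rfl⟩ : {n | ∃ m : List I, m.length = n ∧
      G.wordProd m = G.wordProd l}.Nonempty)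
  exact ⟨m, h2, h1⟩

/-! ## Every real coroot is positive or negative -/

lemma rank_two_coeff {i j : I} (hij : i ≠ j) {v : I →₀ ℤ} (hv : 0 ≤ v)
    (hsupp : ∀ k, k ≠ i → k ≠ j → v k = 0)
    (hq : pair (G.nu v) v = 2 / G.d i ∨ pair (G.nu v) v = 2 / G.d j)
    (hneg : G.dual.qrefl i v i < 0) : v = Finsupp.single i (v i) := by
  classical
  have hv' : v = Finsupp.single i (v i) + Finsupp.single j (v j) := by
    ext k
    by_cases h1 : k = i
    · subst h1; simp [hij]
    · by_cases h2 : k = j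
      · subst h2; simp [h1]
      · simp [hsupp k h1 h2, Ne.symm h1, Ne.symm h2]
  have ha := hv i
  have hb := hv j
  rw [Finsupp.coe_zero, Pi.zero_apply] at ha hb
  generalize v i = a at *
  generalize v j = b at *
  subst hv'
  suffices hb0 : b = 0 by simp [hb0]
  by_contra hb0
  have hb1 : 1 ≤ b := by omega
  rw [dual_qrefl_apply_self, rootPair_add, rootPair_single, rootPair_single, G.a_diag] at hneg
  simp [hij] at hneg
  have hN := G.a_offdiag j i hij.symm
  have h1 : 1 ≤ a + b * G.a j i := by linarith
  have ha1 : 1 ≤ a := by nlinarith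
  have hdi := G.d_pos i
  have hdj := G.d_pos j
  have hQ : pair (G.nu (Finsupp.single i a + Finsupp.single j b))
      (Finsupp.single i a + Finsupp.single j b)
      = 2 * (a * (a + b * G.a j i)) / G.d i + 2 * b ^ 2 / G.d j := by
    have hs := G.symm i j
    rw [pair_add, pair_single, pair_single]
    simp only [nu, pair_add, pair_single, G.a_diag]
    have hd1 := hdi.ne'
    have hd2 := hdj.ne'
    push_cast
    field_simp
    linear_combination ((a : ℝ) * b) * hs
  rw [hQ] at hq
  have e1 : (1 : ℝ) ≤ a * (a + b * G.a j i) := by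
    have : 1 ≤ a * (a + b * G.a j i) := by nlinarith
    exact_mod_cast this
  have e2 : (1 : ℝ) ≤ (b : ℝ) ^ 2 := by
    have : 1 ≤ b ^ 2 := by nlinarith
    exact_mod_cast this
  have f1 : 2 / G.d i ≤ 2 * (a * (a + b * G.a j i)) / G.d i := by gcongr; linarith
  have f2 : 2 / G.d j ≤ 2 * (b : ℝ) ^ 2 / G.d j := by gcongr; linarith
  have g1 : 0 < 2 / G.d i := by positivity
  have g2 : 0 < 2 / G.d j := by positivity
  rcases hq with hq | hq <;> linarith

lemma rank_two_word {i j : I} (hij : i ≠ j) (p : List I) (hp : ∀ k ∈ p, k = i ∨ k = j) :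
    0 ≤ G.corootHom p (Finsupp.single i 1) ∨
      ∃ p₁ k p₂ c, p = p₁ ++ k :: p₂ ∧
        G.corootHom p₂ (Finsupp.single i 1) = Finsupp.single k c := by
  classical
  induction p with
  | nil => left; simp
  | cons k p ih =>
    have hp' : ∀ m ∈ p, m = i ∨ m = j := fun m hm => hp m (by simp [hm])
    rcases ih hp' with h | ⟨p₁, m, p₂, c, rfl, h⟩
    · by_cases hk : 0 ≤ G.corootHom (k :: p) (Finsupp.single i 1)
      · exact Or.inl hk
      · right
        refine ⟨[], k, p, G.corootHom p (Finsupp.single i 1) k, rfl, ?_⟩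
        have hneg : G.dual.qrefl k (G.corootHom p (Finsupp.single i 1)) k < 0 := by
          by_contra hc
          refine hk fun m => ?_
          rw [corootHom_cons]
          by_cases hm : m = k
          · subst hm; simpa using hc
          · rw [dual_qrefl_apply_of_ne _ hm]; exact h m
        have hs : ∀ m, m ≠ i → m ≠ j → G.corootHom p (Finsupp.single i 1) m = 0 := by
          intro m h1 h2
          rw [corootHom_apply_of_forall_ne _ (fun n hn e => by
            rcases hp' n hn with r | r
            · exact h1 (e.trans r)
            · exact h2 (e.trans r))]
          simp [Ne.symm h1]
        rcases hp k (by simp) with rfl | rfl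
        · exact G.rank_two_coeff hij h hs (Or.inl (G.pair_nu_corootHom p _)) hneg
        · exact G.rank_two_coeff hij.symm h (fun m h1 h2 => hs m h2 h1)
            (Or.inr (G.pair_nu_corootHom p _)) hneg
    · exact Or.inr ⟨k :: p₁, m, p₂, c, rfl, h⟩

lemma corootHom_nonneg_of_length_le (l : List I) (i : I)
    (h : G.length (G.wordProd l) ≤ G.length (G.wordProd l * G.srefl i)) :
    0 ≤ G.corootHom l (Finsupp.single i 1) := by
  classical
  induction hn : G.length (G.wordProd l) using Nat.strong_induction_on generalizing l i with
  | _ n IH =>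
  obtain ⟨l₀, hl₀, hlen⟩ := G.exists_reduced l
  rcases List.eq_nil_or_concat l₀ with rfl | ⟨l', j, hl'⟩
  · rw [← G.corootHom_congr hl₀]; simp
  rw [List.concat_eq_append] at hl'
  subst hl'
  have hlen' : l'.length + 1 = n := by rw [← hn, ← hlen]; simp
  have hij : i ≠ j := by
    rintro rfl
    have e : G.wordProd l * G.srefl i = G.wordProd l' := by
      rw [← hl₀, wordProd_append, wordProd_cons, wordProd_nil, mul_one, mul_assoc,
        srefl_mul_self, mul_one]
    rw [e, hn] at h
    have := G.length_wordProd_le l'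
    omega
  have hex : ∃ m, ∃ v p : List I, (∀ k ∈ p, k = i ∨ k = j) ∧
      G.wordProd (v ++ p) = G.wordProd l ∧ v.length + p.length = n ∧ v.length = m :=
    ⟨l'.length, l', [j], by simp, hl₀, by simpa using hlen', rfl⟩
  obtain ⟨v, p, hp, hvp, hlvp, hvm⟩ := Nat.find_spec hex
  have hmin : ∀ v' p' : List I, (∀ k ∈ p', k = i ∨ k = j) →
      G.wordProd (v' ++ p') = G.wordProd l → v'.length + p'.length = n →
      v.length ≤ v'.length := fun v' p' h1 h2 h3 => by
    rw [hvm]; exact Nat.find_min' hex ⟨v', p', h1, h2, h3, rfl⟩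
  have hvlt : v.length < n := by
    have := hmin l' [j] (by simp) hl₀ (by simpa using hlen')
    omega
  have hvred : G.length (G.wordProd v) = v.length := by
    refine le_antisymm (G.length_wordProd_le v) ?_
    obtain ⟨v', hv', hlv'⟩ := G.exists_reduced v
    have := G.length_wordProd_le (v' ++ p)
    rw [wordProd_append, hv', ← wordProd_append, hvp, hn, List.length_append] at this
    omega
  have hpos : ∀ k, k = i ∨ k = j → 0 ≤ G.corootHom v (Finsupp.single k 1) := by
    intro k hk
    refine IH v.length hvlt v k ?_ hvred
    by_contra hc
    have e : G.wordProd v * G.srefl k = G.wordProd (v ++ [k]) := by simp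
    rw [e] at hc
    obtain ⟨v', hv', hlv'⟩ := G.exists_reduced (v ++ [k])
    have hw : G.wordProd (v' ++ k :: p) = G.wordProd l := by
      rw [wordProd_append, hv', ← e, wordProd_cons, mul_assoc, ← mul_assoc (G.srefl k),
        srefl_mul_self, one_mul, ← wordProd_append, hvp]
    have h1 := G.length_wordProd_le (v' ++ k :: p)
    rw [hw, hn] at h1
    simp only [List.length_append, List.length_cons] at h1
    have := hmin v' (k :: p) (by
      intro m hm
      rcases List.mem_cons.mp hm with rfl | hm
      · exact hk
      · exact hp m hm) hw (by simp only [List.length_cons]; omega)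
    omega
  rw [← G.corootHom_congr hvp, corootHom_append]
  rcases G.rank_two_word hij p hp with h2 | ⟨p₁, k, p₂, c, rfl, h2⟩
  · refine G.corootHom_nonneg h2 fun k hk => hpos k ?_
    by_contra hc
    push Not at hc
    refine hk ?_
    rw [corootHom_apply_of_forall_ne _ (fun n hn e => by
      rcases hp n hn with r | r
      · exact hc.1 (e.trans r)
      · exact hc.2 (e.trans r))]
    simp [Ne.symm hc.1]
  · exfalso
    rw [hn, ← hvp, wordProd_append, mul_assoc, G.wordProd_append_mul_srefl h2,
      ← wordProd_append] at h
    have h3 := G.length_wordProd_le (v ++ (p₁ ++ p₂))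
    simp only [List.length_append, List.length_cons] at h3 hlvp
    omega

lemma corootHom_nonneg_or_nonpos (l : List I) (i : I) :
    0 ≤ G.corootHom l (Finsupp.single i 1) ∨ G.corootHom l (Finsupp.single i 1) ≤ 0 := by
  rcases le_total (G.length (G.wordProd l)) (G.length (G.wordProd l * G.srefl i)) with h | h
  · exact Or.inl (G.corootHom_nonneg_of_length_le l i h)
  · right
    have e : G.wordProd (l ++ [i]) = G.wordProd l * G.srefl i := by simp
    have h1 := G.corootHom_nonneg_of_length_le (l ++ [i]) i (by
      rw [e, mul_assoc, srefl_mul_self, mul_one]; exact h)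
    rw [corootHom_append, corootHom_singleton_self, map_neg] at h1
    exact neg_nonneg.mp h1

/-! ## The exchange property -/

lemma exists_split {l u : List I} {i : I} (hu : 0 ≤ G.corootHom u (Finsupp.single i 1))
    (hl : ¬ 0 ≤ G.corootHom (l ++ u) (Finsupp.single i 1)) :
    ∃ l₁ k l₂ c, l = l₁ ++ k :: l₂ ∧
      G.corootHom (l₂ ++ u) (Finsupp.single i 1) = Finsupp.single k c := by
  classical
  induction l with
  | nil => exact absurd hu hl
  | cons k l ih =>
    by_cases h : 0 ≤ G.corootHom (l ++ u) (Finsupp.single i 1)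
    · refine ⟨[], k, l, G.corootHom (l ++ u) (Finsupp.single i 1) k, rfl, ?_⟩
      have h2 := (G.corootHom_nonneg_or_nonpos (k :: l ++ u) i).resolve_left hl
      ext j
      by_cases hj : j = k
      · subst hj; simp
      · have h3 := h2 j
        rw [List.cons_append, corootHom_cons, dual_qrefl_apply_of_ne _ hj] at h3
        rw [le_antisymm h3 (h j)]
        simp [Ne.symm hj]
    · obtain ⟨l₁, m, l₂, c, rfl, h2⟩ := ih h
      exact ⟨k :: l₁, m, l₂, c, rfl, h2⟩

lemma length_mul_reflection_lt {l u : List I} {i : I}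
    (hu : 0 ≤ G.corootHom u (Finsupp.single i 1))
    (hl : ¬ 0 ≤ G.corootHom (l ++ u) (Finsupp.single i 1)) :
    G.length (G.wordProd l * (G.wordProd u * G.srefl i * (G.wordProd u)⁻¹))
      < G.length (G.wordProd l) := by
  obtain ⟨m, hm, hlen⟩ := G.exists_reduced l
  rw [G.corootHom_congr (m := m ++ u) (by simp [hm])] at hl
  obtain ⟨l₁, k, l₂, c, rfl, h2⟩ := G.exists_split hu hl
  have h3 := G.wordProd_append_mul_srefl (l := l₁) h2
  have e : G.wordProd l * (G.wordProd u * G.srefl i * (G.wordProd u)⁻¹)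
      = G.wordProd (l₁ ++ l₂) := by
    rw [← hm, ← mul_assoc, mul_inv_eq_iff_eq_mul, ← mul_assoc, ← wordProd_append,
      ← wordProd_append, List.append_assoc, List.append_assoc, List.cons_append, h3]
  rw [e, ← hlen]
  have := G.length_wordProd_le (l₁ ++ l₂)
  simp only [List.length_append, List.length_cons] at this ⊢
  omega

/-! ## Parabolic subgroups -/

lemma mem_closure_iff {S : I → Prop} {w : Equiv.Perm (I → ℝ)} :
    w ∈ Subgroup.closure {p : Equiv.Perm (I → ℝ) | ∃ i, S i ∧ p = G.srefl i} ↔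
      ∃ l : List I, (∀ k ∈ l, S k) ∧ G.wordProd l = w := by
  constructor
  · intro h
    induction h using Subgroup.closure_induction'' with
    | one => exact ⟨[], by simp, rfl⟩
    | mem p hp =>
      obtain ⟨i, hi, rfl⟩ := hp
      exact ⟨[i], by simpa using hi, by simp⟩
    | inv_mem p hp =>
      obtain ⟨i, hi, rfl⟩ := hp
      exact ⟨[i], by simpa using hi, by simp [srefl_inv]⟩
    | mul p q _ _ hp hq =>
      obtain ⟨l, hl, rfl⟩ := hp
      obtain ⟨m, hm, rfl⟩ := hq
      refine ⟨l ++ m, fun k hk => ?_, by simp⟩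
      rcases List.mem_append.mp hk with hk | hk
      · exact hl k hk
      · exact hm k hk
  · rintro ⟨l, hl, rfl⟩
    induction l with
    | nil => exact Subgroup.one_mem _
    | cons k l ih =>
      rw [wordProd_cons]
      exact Subgroup.mul_mem _ (Subgroup.subset_closure ⟨k, hl k (by simp), rfl⟩)
        (ih fun m hm => hl m (by simp [hm]))

/-- The reflection in a positive coroot supported in `S` belongs to the parabolic
subgroup attached to `S`. -/
lemma reflection_mem_closure {S : I → Prop} (u : List I) (i : I)
    (hu : 0 ≤ G.corootHom u (Finsupp.single i 1))
    (hS : ∀ k, G.corootHom u (Finsupp.single i 1) k ≠ 0 → S k) :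
    G.wordProd u * G.srefl i * (G.wordProd u)⁻¹ ∈
      Subgroup.closure {p : Equiv.Perm (I → ℝ) | ∃ i, S i ∧ p = G.srefl i} := by
  classical
  induction hn : ((G.corootHom u (Finsupp.single i 1)).sum fun _ c => c).toNat
    using Nat.strong_induction_on generalizing u with
  | _ n IH =>
  obtain ⟨k, hk0, hk⟩ : ∃ k, 0 < G.corootHom u (Finsupp.single i 1) k ∧
      0 < G.nu (G.corootHom u (Finsupp.single i 1)) k := by
    by_contra hc
    push Not at hc
    have h1 : pair (G.nu (G.corootHom u (Finsupp.single i 1)))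
        (G.corootHom u (Finsupp.single i 1)) ≤ 0 := by
      refine Finset.sum_nonpos fun k hk => ?_
      have h0 : 0 < G.corootHom u (Finsupp.single i 1) k :=
        lt_of_le_of_ne (hu k) (Ne.symm (Finsupp.mem_support_iff.mp hk))
      exact mul_nonpos_of_nonneg_of_nonpos (by exact_mod_cast h0.le) (hc k h0)
    rw [pair_nu_corootHom] at h1
    have := div_pos two_pos (G.d_pos i)
    linarith
  have hkS := Subgroup.subset_closure
    (show G.srefl k ∈ {p : Equiv.Perm (I → ℝ) | ∃ i, S i ∧ p = G.srefl i} from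
      ⟨k, hS k hk0.ne', rfl⟩)
  by_cases hsingle : G.corootHom u (Finsupp.single i 1)
      = Finsupp.single k (G.corootHom u (Finsupp.single i 1) k)
  · rw [G.wordProd_mul_srefl hsingle, mul_inv_cancel_right]
    exact hkS
  obtain ⟨j, hjk, hj⟩ : ∃ j, j ≠ k ∧ 0 < G.corootHom u (Finsupp.single i 1) j := by
    by_contra hc
    push Not at hc
    refine hsingle (Finsupp.ext fun j => ?_)
    by_cases hj : j = k
    · subst hj; simp
    · rw [le_antisymm (hc j hj) (hu j)]
      simp [Ne.symm hj]
  have hpos : 0 ≤ G.corootHom (k :: u) (Finsupp.single i 1) := by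
    refine (G.corootHom_nonneg_or_nonpos (k :: u) i).resolve_right fun h => ?_
    have h1 := h j
    rw [corootHom_cons, dual_qrefl_apply_of_ne _ hjk] at h1
    exact absurd hj (not_lt.mpr h1)
  have hm : 0 < G.rootPair k (G.corootHom u (Finsupp.single i 1)) := by
    have : (0 : ℝ) < G.rootPair k (G.corootHom u (Finsupp.single i 1)) := by
      rw [rootPair_eq]
      exact mul_pos (G.d_pos k) hk
    exact_mod_cast this
  have hlt : ((G.corootHom (k :: u) (Finsupp.single i 1)).sum fun _ c => c).toNat < n := by
    have h1 : ((G.corootHom (k :: u) (Finsupp.single i 1)).sum fun _ c => c)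
        = ((G.corootHom u (Finsupp.single i 1)).sum fun _ c => c)
          - G.rootPair k (G.corootHom u (Finsupp.single i 1)) := by
      rw [corootHom_cons, dual_qrefl_apply, Finsupp.sum_sub_index (by simp),
        Finsupp.sum_single_index rfl]
    have h2 : 0 ≤ (G.corootHom (k :: u) (Finsupp.single i 1)).sum fun _ c => c :=
      Finset.sum_nonneg fun k _ => hpos k
    omega
  have hrec := IH _ hlt (k :: u) hpos (fun m hm' => by
    by_cases hmk : m = k
    · subst hmk; exact hS m hk0.ne'
    · rw [corootHom_cons, dual_qrefl_apply_of_ne _ hmk] at hm'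
      exact hS m hm') rfl
  have e : G.wordProd u * G.srefl i * (G.wordProd u)⁻¹
      = G.srefl k * (G.wordProd (k :: u) * G.srefl i * (G.wordProd (k :: u))⁻¹)
        * G.srefl k := by
    rw [wordProd_cons, mul_inv_rev, srefl_inv]
    simp only [mul_assoc]
    rw [srefl_mul_self, mul_one, ← mul_assoc (G.srefl k), srefl_mul_self, one_mul]
  rw [e]
  exact Subgroup.mul_mem _ (Subgroup.mul_mem _ hkS hrec) hkS

/-- An element mapping all simple coroots of a parabolic to positive coroots has minimal
length in its coset. -/
lemma length_le_of_nonneg {S : I → Prop} (y : List I)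
    (hy : ∀ i, S i → 0 ≤ G.corootHom y (Finsupp.single i 1))
    (q : Equiv.Perm (I → ℝ))
    (hq : q ∈ Subgroup.closure {p : Equiv.Perm (I → ℝ) | ∃ i, S i ∧ p = G.srefl i}) :
    G.length (G.wordProd y) ≤ G.length (G.wordProd y * q) := by
  classical
  have hex : ∃ n, ∃ z : List I, (∃ p : List I, (∀ k ∈ p, S k) ∧
      G.wordProd y = G.wordProd (z ++ p)) ∧ G.length (G.wordProd z) = n :=
    ⟨_, y, ⟨[], by simp, by simp⟩, rfl⟩
  obtain ⟨z, hzp, hz⟩ := Nat.find_spec hex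
  have hzmin : ∀ z' p' : List I, (∀ k ∈ p', S k) → G.wordProd y = G.wordProd (z' ++ p') →
      G.length (G.wordProd z) ≤ G.length (G.wordProd z') := fun z' p' h1 h2 => by
    rw [hz]; exact Nat.find_min' hex ⟨z', ⟨p', h1, h2⟩, rfl⟩
  have hex' : ∃ n, ∃ p : List I, (∀ k ∈ p, S k) ∧
      G.wordProd y = G.wordProd (z ++ p) ∧ p.length = n :=
    hzp.elim fun p hp => ⟨_, p, hp.1, hp.2, rfl⟩
  obtain ⟨p, hp, hzp, hplen⟩ := Nat.find_spec hex'
  have hpmin : ∀ p' : List I, (∀ k ∈ p', S k) → G.wordProd y = G.wordProd (z ++ p') →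
      p.length ≤ p'.length := fun p' h1 h2 => by
    rw [hplen]; exact Nat.find_min' hex' ⟨p', h1, h2, rfl⟩
  clear hz hplen
  have hzpos : ∀ k, S k → 0 ≤ G.corootHom z (Finsupp.single k 1) := by
    intro k hk
    refine G.corootHom_nonneg_of_length_le z k ?_
    have h1 := hzmin (z ++ [k]) (k :: p) (by
      intro m hm
      rcases List.mem_cons.mp hm with rfl | hm
      · exact hk
      · exact hp m hm) (by
      rw [hzp]
      simp only [wordProd_append, wordProd_cons, wordProd_nil, mul_one, mul_assoc]
      rw [← mul_assoc (G.srefl k), srefl_mul_self, one_mul])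
    simpa using h1
  rcases List.eq_nil_or_concat p with rfl | ⟨p', i, hpi⟩
  · obtain ⟨l, hl, rfl⟩ := G.mem_closure_iff.mp hq
    rw [List.append_nil] at hzp
    have h1 := hzmin (y ++ l) l.reverse (by simpa using hl) (by
      rw [wordProd_append, wordProd_append, mul_assoc, wordProd_mul_reverse, mul_one])
    rwa [← hzp, wordProd_append] at h1
  rw [List.concat_eq_append] at hpi
  subst hpi
  exfalso
  have hiS : S i := hp i (by simp)
  have hp'S : ∀ k ∈ p', S k := fun k hk => hp k (by simp [hk])
  have hp' : 0 ≤ G.corootHom p' (Finsupp.single i 1) := by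
    by_contra hc
    obtain ⟨p₁, k, p₂, c, rfl, h2⟩ := G.exists_split (l := p') (u := []) (i := i)
      (by simp) (by simpa using hc)
    rw [List.append_nil] at h2
    have h3 := hpmin (p₁ ++ p₂) (fun k hk => hp'S k (by
      rcases List.mem_append.mp hk with hk | hk <;> simp [hk])) (by
      rw [hzp, wordProd_append, wordProd_append _ (p₁ ++ k :: p₂), wordProd_cons, wordProd_nil, mul_one,
        G.wordProd_append_mul_srefl h2, ← wordProd_append])
    simp only [List.length_append, List.length_cons, List.length_nil] at h3
    omega
  have hpos : 0 ≤ G.corootHom z (G.corootHom p' (Finsupp.single i 1)) := by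
    refine G.corootHom_nonneg hp' fun k hk => hzpos k ?_
    by_contra hkS
    refine hk ?_
    rw [corootHom_apply_of_forall_ne _ fun m hm (e : k = m) => hkS (e ▸ hp'S m hm)]
    have : i ≠ k := fun e => hkS (e ▸ hiS)
    simp [this]
  have hneg := hy i hiS
  rw [G.corootHom_congr hzp, corootHom_append, corootHom_append, corootHom_singleton_self,
    map_neg, map_neg, neg_nonneg, ← corootHom_append] at hneg
  rw [← corootHom_append] at hpos
  exact G.corootHom_single_ne_zero _ _ (le_antisymm hneg hpos)

/-! ## Minuscule and cominuscule words -/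

variable {Λ : I → ℝ}

lemma MinusculeWord.apply_eq_one {G : SGCM I} {l₁ l₂ : List I} {k : I}
    (h : G.MinusculeWord Λ (l₁ ++ k :: l₂)) : G.wordProd l₂ Λ k = 1 := by
  induction l₁ with
  | nil => exact h.2
  | cons m l₁ ih => exact ih h.1

lemma corootHom_nonneg_of_minusculeWord {l : List I} (h : G.MinusculeWord Λ l) {i : I}
    (hi : Λ i = 0) : 0 ≤ G.corootHom l (Finsupp.single i 1) := by
  by_contra hc
  obtain ⟨l₁, k, l₂, c, rfl, h2⟩ := G.exists_split (l := l) (u := []) (i := i)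
    (by simp) (by simpa using hc)
  rw [List.append_nil] at h2
  have h3 := G.pair_wordProd l₂ Λ (Finsupp.single i 1)
  rw [← corootHom_apply, h2, pair_single, pair_single, h.apply_eq_one, hi, mul_zero,
    mul_one, Int.cast_eq_zero] at h3
  rw [h3, Finsupp.single_zero] at h2
  exact G.corootHom_single_ne_zero _ _ h2

lemma pair_eq_of_scaled {r v : I →₀ ℤ} {e : ℝ} (h : ∀ j, (r j : ℝ) * G.d j = e * v j)
    (mu : I → ℝ) : pair (fun j => G.d j * mu j) r = e * pair mu v := by
  classical
  rw [pair, pair, Finsupp.sum_of_support_subset r Finset.subset_union_left _ (by simp),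
    Finsupp.sum_of_support_subset v (Finset.subset_union_right (s₁ := r.support)) _ (by simp),
    Finset.mul_sum]
  refine Finset.sum_congr rfl fun j _ => ?_
  linear_combination (mu j) * h j

/-- The root and coroot obtained by applying a word to a simple root and to the
corresponding simple coroot have proportional coordinates. -/
lemma dual_corootHom_mul (l : List I) (i j : I) :
    (G.dual.corootHom l (Finsupp.single i 1) j : ℝ) * G.d j
      = G.d i * G.corootHom l (Finsupp.single i 1) j := by
  classical
  induction l generalizing j with
  | nil =>
    by_cases h : i = j
    · subst h; simp
    · simp [h]
  | cons k l ih =>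
    rw [corootHom_cons, corootHom_cons]
    by_cases hj : j = k
    · subst hj
      rw [dual_qrefl_apply_self, dual_qrefl_apply_self]
      push_cast
      rw [cast_rootPair, cast_rootPair, mul_sub, ← G.pair_eq_of_scaled ih, sub_mul, ih]
      congr 1
      simp only [pair, Finsupp.sum, Finset.sum_mul]
      refine Finset.sum_congr rfl fun m _ => ?_
      have := G.symm j m
      change _ * (G.a j m : ℝ) * G.d j = _
      linear_combination ((G.dual.corootHom l (Finsupp.single i 1) m : ℤ) : ℝ) * this
    · rw [dual_qrefl_apply_of_ne _ hj, dual_qrefl_apply_of_ne _ hj, ih]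

lemma corootHom_nonneg_of_dual_minusculeWord {l : List I} (h : G.dual.MinusculeWord Λ l) {i : I}
    (hi : Λ i = 0) : 0 ≤ G.corootHom l (Finsupp.single i 1) := by
  have h1 := G.dual.corootHom_nonneg_of_minusculeWord h hi
  intro j
  have h2 := G.dual_corootHom_mul l i j
  have h3 : (0 : ℝ) ≤ G.dual.corootHom l (Finsupp.single i 1) j := by exact_mod_cast h1 j
  have h4 := mul_nonneg h3 (G.d_pos j).le
  rw [h2] at h4
  exact_mod_cast nonneg_of_mul_nonneg_right h4 (G.d_pos i)

lemma IsCoMin.exists_word {G : SGCM I} {x : Equiv.Perm (I → ℝ)} (hx : G.IsCoMin Λ x) :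
    ∃ l : List I, G.wordProd l = x ∧
      ∀ i, Λ i = 0 → 0 ≤ G.corootHom l (Finsupp.single i 1) := by
  rcases hx with ⟨l, -, hl, h⟩ | ⟨l, -, hl, h⟩
  · exact ⟨l, hl, fun i hi => G.corootHom_nonneg_of_minusculeWord h hi⟩
  · exact ⟨l, hl, fun i hi => G.corootHom_nonneg_of_dual_minusculeWord h hi⟩

end SGCM

end KM

/-- Let `Λ` be dominant, `x` a `Λ`-(co)minuscule element,
`S(x) = {α : ⟨x(Λ), α^∨⟩ ≥ 0}`, `W_x` the subgroup generated by `{s_α : α ∈ S(x)}`, and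
let `w ∈ W_x` be of minimal length in its coset modulo the stabilizer of `x(Λ)` in
`W_x`. Then `w x` is of minimal length in its coset modulo
`W_P = ⟨s_γ : ⟨Λ, γ^∨⟩ = 0⟩`, i.e. `w x ∈ W^P`. -/
theorem statement6 {I : Type} (G : KM.SGCM I) (Λ : I → ℝ) (hdom : ∀ i, 0 ≤ Λ i)
    (x : Equiv.Perm (I → ℝ)) (hx : G.IsCoMin Λ x)
    (w : Equiv.Perm (I → ℝ))
    (hwWx : w ∈ Subgroup.closure
      {p : Equiv.Perm (I → ℝ) | ∃ α, 0 ≤ x Λ α ∧ p = G.srefl α})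
    (hmin : ∀ q ∈ Subgroup.closure
        {p : Equiv.Perm (I → ℝ) | ∃ α, 0 ≤ x Λ α ∧ p = G.srefl α},
      q (x Λ) = x Λ → G.length w ≤ G.length (w * q)) :
    ∀ q ∈ Subgroup.closure {p : Equiv.Perm (I → ℝ) | ∃ i, Λ i = 0 ∧ p = G.srefl i},
      G.length (w * x) ≤ G.length (w * x * q) := by
  obtain ⟨lx, rfl, hlx⟩ := hx.exists_word
  obtain ⟨lw, hlw, rfl⟩ := G.mem_closure_iff.mp hwWx
  rw [← KM.SGCM.wordProd_append]
  refine G.length_le_of_nonneg (S := fun i => Λ i = 0) (lw ++ lx) fun i hi => ?_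
  by_cases hS : ∀ k, G.corootHom lx (Finsupp.single i 1) k ≠ 0 → 0 ≤ G.wordProd lx Λ k
  · by_contra hneg
    have hfix : G.srefl i Λ = Λ := by
      simp [KM.SGCM.srefl_apply, hi]
    refine absurd (hmin _ (G.reflection_mem_closure lx i (hlx i hi) hS) ?_)
      (not_le.mpr (G.length_mul_reflection_lt (hlx i hi) hneg))
    simp [hfix]
  · push Not at hS
    obtain ⟨j, hj0, hj⟩ := hS
    refine (G.corootHom_nonneg_or_nonpos (lw ++ lx) i).resolve_right fun hneg => hj0 ?_
    have h1 := hneg j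
    rw [KM.SGCM.corootHom_append, KM.SGCM.corootHom_apply_of_forall_ne _
      (fun k hk (e : j = k) => not_le.mpr hj (e ▸ hlw k hk))] at h1
    exact le_antisymm h1 (hlx i hi j)
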